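/- arXiv:2005.09176 — 3 statements merged into one kernel-verified Lean document; each statement's English description precedes it below -/
import Mathlib

section
/- Let ν₀ > 0 and consider the 2×2 complex matrices B = [[0, −1/2],[1/2, 0]] and M∞ = [[0, 0],[2ν₀², 0]]. Then the set { λ ∈ ℂ : ∃ μ ∈ ℝ such that det(λI − M∞ + μ² B) = 0 } equals the set { λ ∈ ℂ : ∃ μ ∈ ℝ such that λ² = μ²(4ν₀² − μ²)/4 }, which is the union of the imaginary axis { λ ∈ ℂ : Re λ = 0 } and the real segment { λ ∈ ℂ : Im λ = 0 and |Re λ| ≤ ν₀² }. -/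
open Matrix

/-- The quartic `μ²(4ν² − μ²)/4` takes exactly the real values `r ≤ ν⁴`. -/
theorem exists_sq_mul_sub_sq_div_four_eq_iff (ν r : ℝ) :
    (∃ μ : ℝ, r = μ ^ 2 * (4 * ν ^ 2 - μ ^ 2) / 4) ↔ r ≤ ν ^ 4 := by
  constructor
  · rintro ⟨μ, rfl⟩
    nlinarith [sq_nonneg (μ ^ 2 - 2 * ν ^ 2)]
  · intro h
    refine ⟨√(2 * ν ^ 2 + 2 * √(ν ^ 4 - r)), ?_⟩
    rw [Real.sq_sqrt (by positivity)]
    linarith [Real.sq_sqrt (sub_nonneg.2 h)]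

/-- The square of `l` is a given real number iff its real and imaginary parts match. -/
theorem Complex.sq_eq_ofReal_iff (l : ℂ) (r : ℝ) :
    l ^ 2 = (r : ℂ) ↔ r = l.re ^ 2 - l.im ^ 2 ∧ l.re * l.im = 0 := by
  rw [Complex.ext_iff]
  simp only [pow_two, Complex.mul_re, Complex.mul_im, Complex.ofReal_re, Complex.ofReal_im]
  constructor <;> rintro ⟨h₁, h₂⟩ <;> constructor <;> linarith

/-- For the Kuznetsov–Ma linearization matrices `B = [[0,−1/2],[1/2,0]]` and
`M∞ = [[0,0],[2ν₀²,0]]`, the set `{λ : ∃ μ ∈ ℝ, det(λI − M∞ + μ²B) = 0}` equals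
`{λ : ∃ μ ∈ ℝ, λ² = μ²(4ν₀² − μ²)/4}`, which is the union of the imaginary axis
and the real segment `{λ : Im λ = 0, |Re λ| ≤ ν₀²}`. -/
theorem km_asymptotic_essential_spectrum
    (ν₀ : ℝ) (hν₀ : 0 < ν₀)
    (B Minf : Matrix (Fin 2) (Fin 2) ℂ)
    (hB : B = !![0, -(1 / 2 : ℂ); (1 / 2 : ℂ), 0])
    (hM : Minf = !![0, 0; 2 * (ν₀ : ℂ) ^ 2, 0]) :
    {l : ℂ | ∃ μ : ℝ,
        (l • (1 : Matrix (Fin 2) (Fin 2) ℂ) - Minf + ((μ : ℂ) ^ 2) • B).det = 0}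
      = {l : ℂ | ∃ μ : ℝ, l ^ 2 = (μ : ℂ) ^ 2 * (4 * (ν₀ : ℂ) ^ 2 - (μ : ℂ) ^ 2) / 4} ∧
    {l : ℂ | ∃ μ : ℝ, l ^ 2 = (μ : ℂ) ^ 2 * (4 * (ν₀ : ℂ) ^ 2 - (μ : ℂ) ^ 2) / 4}
      = {l : ℂ | l.re = 0} ∪ {l : ℂ | l.im = 0 ∧ |l.re| ≤ ν₀ ^ 2} := by
  subst hB hM
  constructor
  · ext l
    refine exists_congr fun μ => ?_
    rw [← sub_eq_zero (a := l ^ 2), Matrix.det_fin_two]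
    simp only [Matrix.add_apply, Matrix.sub_apply, Matrix.smul_apply, Matrix.one_apply,
      Matrix.of_apply, Matrix.cons_val', Matrix.cons_val_zero, Matrix.cons_val_one,
      Matrix.cons_val_fin_one, smul_eq_mul, Fin.isValue, if_true, zero_ne_one, one_ne_zero,
      if_false]
    ring_nf
  · ext l
    have key : (∃ μ : ℝ, l ^ 2 = (μ : ℂ) ^ 2 * (4 * (ν₀ : ℂ) ^ 2 - (μ : ℂ) ^ 2) / 4) ↔
        l.re ^ 2 - l.im ^ 2 ≤ ν₀ ^ 4 ∧ l.re * l.im = 0 := by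
      rw [← exists_sq_mul_sub_sq_div_four_eq_iff, ← exists_and_right]
      refine exists_congr fun μ => ?_
      rw [eq_comm (a := l.re ^ 2 - l.im ^ 2), ← Complex.sq_eq_ofReal_iff]
      push_cast
      rfl
    simp only [Set.mem_ofPred_eq, Set.mem_union, key]
    have habs : |l.re| ≤ ν₀ ^ 2 ↔ l.re ^ 2 ≤ ν₀ ^ 4 := by
      rw [← abs_of_pos (pow_pos hν₀ 2), ← sq_le_sq, ← pow_mul]
    rw [habs]
    constructor
    · rintro ⟨h, h0⟩
      rcases mul_eq_zero.1 h0 with h0 | h0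
      · exact Or.inl h0
      · exact Or.inr ⟨h0, by simpa [h0] using h⟩
    · rintro (h0 | ⟨h0, h⟩)
      · refine ⟨?_, by simp [h0]⟩
        rw [h0]
        nlinarith [sq_nonneg l.im, pow_pos hν₀ 4]
      · exact ⟨by simpa [h0] using h, by simp [h0]⟩
end

section
/- Let β > 0, D ∈ ℝ, and set m = |D|/(2β). Let λ = σ + iτ with σ > 0 and τ ≠ 0, let ξ ∈ ℝ, and let B = [[β, −D/2],[D/2, β]] regarded as a 2×2 complex matrix. Then the matrix −4πξ² B − λ I is invertible and the operator norm of its inverse, with respect to the Euclidean norm on ℂ², satisfies ‖(−4πξ² B − λ I)⁻¹‖ ≤ √(1 + m²)/(mσ + |τ|) ≤ √(1 + m²)/|τ|. -/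
open Matrix

theorem Complex.norm_sq_add_I_mul_add_norm_sq_sub_I_mul (z w : ℂ) :
    ‖z + Complex.I * w‖ ^ 2 + ‖z - Complex.I * w‖ ^ 2 = 2 * (‖z‖ ^ 2 + ‖w‖ ^ 2) := by
  simp only [← Complex.normSq_eq_norm_sq, Complex.normSq_apply, Complex.add_re, Complex.add_im,
    Complex.sub_re, Complex.sub_im, Complex.mul_re, Complex.mul_im, Complex.I_re, Complex.I_im]
  ring

/-- A matrix `[[a, -b], [b, a]]` expands Euclidean norms by at least the smaller of the moduli of
its eigenvalues `a ± ib`. -/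
theorem Matrix.le_norm_toEuclideanCLM_rotation_apply {a b : ℂ} {c : ℝ} (hc : 0 ≤ c)
    (hp : c ≤ ‖a + Complex.I * b‖) (hq : c ≤ ‖a - Complex.I * b‖)
    (v : EuclideanSpace ℂ (Fin 2)) :
    c * ‖v‖ ≤ ‖Matrix.toEuclideanCLM (𝕜 := ℂ) !![a, -b; b, a] v‖ := by
  set w := Matrix.toEuclideanCLM (𝕜 := ℂ) !![a, -b; b, a] v with hw
  have hw₀ : w 0 = a * v 0 - b * v 1 := by
    simp [hw, Matrix.mulVec, dotProduct, Fin.sum_univ_two, sub_eq_add_neg]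
  have hw₁ : w 1 = b * v 0 + a * v 1 := by
    simp [hw, Matrix.mulVec, dotProduct, Fin.sum_univ_two]
  have hplus : w 0 + Complex.I * w 1 = (a + Complex.I * b) * (v 0 + Complex.I * v 1) := by
    rw [hw₀, hw₁]
    linear_combination (-b * v 1) * Complex.I_sq
  have hminus : w 0 - Complex.I * w 1 = (a - Complex.I * b) * (v 0 - Complex.I * v 1) := by
    rw [hw₀, hw₁]
    linear_combination (-b * v 1) * Complex.I_sq
  have hv := Complex.norm_sq_add_I_mul_add_norm_sq_sub_I_mul (v 0) (v 1)
  have hww := Complex.norm_sq_add_I_mul_add_norm_sq_sub_I_mul (w 0) (w 1)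
  rw [hplus, hminus, norm_mul, norm_mul, mul_pow, mul_pow] at hww
  have hp2 : c ^ 2 ≤ ‖a + Complex.I * b‖ ^ 2 := by gcongr
  have hq2 : c ^ 2 ≤ ‖a - Complex.I * b‖ ^ 2 := by gcongr
  have h₁ := mul_le_mul_of_nonneg_right hp2 (sq_nonneg ‖v 0 + Complex.I * v 1‖)
  have h₂ := mul_le_mul_of_nonneg_right hq2 (sq_nonneg ‖v 0 - Complex.I * v 1‖)
  refine le_of_sq_le_sq ?_ (norm_nonneg _)
  rw [mul_pow, EuclideanSpace.norm_sq_eq, EuclideanSpace.norm_sq_eq, Fin.sum_univ_two,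
    Fin.sum_univ_two]
  linear_combination (h₁ + h₂ + hww - c ^ 2 * hv) / 2

theorem Matrix.isUnit_rotation {a b : ℂ} (hp : a + Complex.I * b ≠ 0)
    (hq : a - Complex.I * b ≠ 0) : IsUnit !![a, -b; b, a] := by
  rw [Matrix.isUnit_iff_isUnit_det, isUnit_iff_ne_zero, Matrix.det_fin_two_of]
  have h : a * a - -b * b = (a + Complex.I * b) * (a - Complex.I * b) := by
    linear_combination b ^ 2 * Complex.I_sq
  rw [h]
  exact mul_ne_zero hp hq

theorem Matrix.norm_toEuclideanCLM_inv_le {n : Type*} [Fintype n] [DecidableEq n]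
    {A : Matrix n n ℂ} (hA : IsUnit A) {c : ℝ} (hc : 0 < c)
    (h : ∀ v, c * ‖v‖ ≤ ‖Matrix.toEuclideanCLM (𝕜 := ℂ) A v‖) :
    ‖Matrix.toEuclideanCLM (𝕜 := ℂ) A⁻¹‖ ≤ c⁻¹ := by
  refine ContinuousLinearMap.opNorm_le_bound _ (by positivity) fun w => ?_
  have hw : Matrix.toEuclideanCLM (𝕜 := ℂ) A (Matrix.toEuclideanCLM (𝕜 := ℂ) A⁻¹ w) = w := by
    rw [← mul_apply_eq_comp, ← map_mul,
      Matrix.mul_nonsing_inv A ((Matrix.isUnit_iff_isUnit_det A).1 hA), map_one,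
      one_apply_eq_self]
  have hle := h (Matrix.toEuclideanCLM (𝕜 := ℂ) A⁻¹ w)
  rw [hw] at hle
  rwa [inv_mul_eq_div, le_div_iff₀' hc]

/-- Cauchy–Schwarz against the direction `(m, 1)`: distance from the origin to the eigenvalue
with real part `-(x + σ)` and imaginary part `-(τ + y)`, where `|y| = m * x`. -/
theorem div_sqrt_le_norm_of_abs_eq {m x y σ τ : ℝ} (hm : 0 ≤ m) (hσ : 0 ≤ σ)
    (hy : |y| = m * x) {z : ℂ} (hre : z.re = -(x + σ)) (him : z.im = -(τ + y)) :
    (m * σ + |τ|) / √(1 + m ^ 2) ≤ ‖z‖ := by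
  have hτ : |τ| ≤ |τ + y| + m * x := by
    rw [← hy]
    simpa using abs_sub (τ + y) y
  rw [div_le_iff₀ (by positivity), Complex.norm_eq_sqrt_sq_add_sq,
    ← Real.sqrt_mul (by positivity), hre, him, neg_sq, neg_sq]
  refine Real.le_sqrt_of_sq_le ?_
  calc (m * σ + |τ|) ^ 2 ≤ (m * (x + σ) + |τ + y|) ^ 2 := by
        gcongr ?_ ^ 2
        linarith
    _ ≤ ((x + σ) ^ 2 + |τ + y| ^ 2) * (1 + m ^ 2) := by
        linarith [sq_nonneg (m * |τ + y| - (x + σ))]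
    _ = ((x + σ) ^ 2 + (τ + y) ^ 2) * (1 + m ^ 2) := by rw [sq_abs]

/-- Uniform-in-`ξ` Fourier-symbol bound: for `β > 0`, `m = |D|/(2β)`,
`λ = σ + iτ` with `σ > 0`, `τ ≠ 0`, the matrix `−4πξ²B − λI` (with
`B = [[β,−D/2],[D/2,β]]`) is invertible and the Euclidean operator norm of its
inverse is at most `√(1+m²)/(mσ+|τ|) ≤ √(1+m²)/|τ|`. -/
theorem symbol_sectorial_resolvent_bound
    (β D : ℝ) (hβ : 0 < β) (m : ℝ) (hm : m = |D| / (2 * β))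
    (σ τ : ℝ) (hσ : 0 < σ) (hτ : τ ≠ 0)
    (l : ℂ) (hl : l = (σ : ℂ) + Complex.I * (τ : ℂ))
    (ξ : ℝ)
    (B : Matrix (Fin 2) (Fin 2) ℂ)
    (hB : B = !![(β : ℂ), -((D : ℂ) / 2); (D : ℂ) / 2, (β : ℂ)]) :
    IsUnit ((-(4 * Real.pi * ξ ^ 2) : ℂ) • B - l • (1 : Matrix (Fin 2) (Fin 2) ℂ)) ∧
    ‖Matrix.toEuclideanCLM (𝕜 := ℂ)
        (((-(4 * Real.pi * ξ ^ 2) : ℂ) • B - l • (1 : Matrix (Fin 2) (Fin 2) ℂ))⁻¹)‖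
      ≤ Real.sqrt (1 + m ^ 2) / (m * σ + |τ|) ∧
    ‖Matrix.toEuclideanCLM (𝕜 := ℂ)
        (((-(4 * Real.pi * ξ ^ 2) : ℂ) • B - l • (1 : Matrix (Fin 2) (Fin 2) ℂ))⁻¹)‖
      ≤ Real.sqrt (1 + m ^ 2) / |τ| := by
  have hm₀ : 0 ≤ m := by rw [hm]; positivity
  have hτ₀ : 0 < |τ| := abs_pos.2 hτ
  set s : ℝ := 4 * Real.pi * ξ ^ 2 with hs
  have hs₀ : 0 ≤ s := by positivity
  have hsC : (4 * Real.pi * ξ ^ 2 : ℂ) = (s : ℂ) := by rw [hs]; push_cast; ring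
  have hA : (-(4 * Real.pi * ξ ^ 2) : ℂ) • B - l • (1 : Matrix (Fin 2) (Fin 2) ℂ) =
      !![-(s * β + l), -(-(s * D / 2)); -(s * D / 2), -(s * β + l)] := by
    rw [hsC, hB]
    ext i j
    fin_cases i <;> fin_cases j <;> simp <;> ring
  rw [hA]
  have hy : |s * D / 2| = m * (s * β) := by
    rw [hm, abs_div, abs_mul, abs_of_nonneg hs₀, abs_two]
    field_simp
  have hp : (m * σ + |τ|) / √(1 + m ^ 2) ≤
      ‖-((s : ℂ) * β + l) + Complex.I * -(s * D / 2)‖ := by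
    refine div_sqrt_le_norm_of_abs_eq (x := s * β) (y := s * D / 2) hm₀ hσ.le
      hy ?_ ?_
    · simp [hl]
    · simp [hl]; ring
  have hq : (m * σ + |τ|) / √(1 + m ^ 2) ≤
      ‖-((s : ℂ) * β + l) - Complex.I * -(s * D / 2)‖ := by
    refine div_sqrt_le_norm_of_abs_eq (x := s * β) (y := -(s * D / 2)) hm₀ hσ.le
      (by rw [abs_neg, hy]) ?_ ?_
    · simp [hl]
    · simp [hl]; ring
  have hc : 0 < (m * σ + |τ|) / √(1 + m ^ 2) := by positivity
  have hunit := Matrix.isUnit_rotation (norm_pos_iff.1 (hc.trans_le hp))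
    (norm_pos_iff.1 (hc.trans_le hq))
  have hbound := Matrix.norm_toEuclideanCLM_inv_le hunit hc
    (Matrix.le_norm_toEuclideanCLM_rotation_apply hc.le hp hq)
  rw [inv_div] at hbound
  refine ⟨hunit, hbound, hbound.trans ?_⟩
  gcongr
  exact le_add_of_nonneg_left (by positivity)
end

section
/- Let M : ℝ → ℝ^{2×2} be a differentiable matrix-valued function such that M and its derivative M′ are bounded (in the matrix norm induced by the Euclidean norm) and ‖M(x)‖ → 0 as |x| → ∞. Then for every C > 0, the subset of L²(ℝ, ℂ²) consisting of the (equivalence classes of the) functions x ↦ M(x) g(x), where g : ℝ → ℂ² ranges over all differentiable functions with g and g′ square-integrable and ∫‖g‖² ≤ C², ∫‖g′‖² ≤ C², is totally bounded in L²(ℝ, ℂ²). -/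
open MeasureTheory Matrix Filter

theorem exists_pos_mul_sq_lt (c : ℝ) {d : ℝ} (hd : 0 < d) : ∃ δ > 0, c * δ ^ 2 < d := by
  have hlim : Tendsto (fun δ : ℝ => c * δ ^ 2) (nhds 0) (nhds 0) :=
    (show Continuous fun δ : ℝ => c * δ ^ 2 by fun_prop).tendsto' 0 0 (by simp)
  obtain ⟨δ, h, hδ⟩ := (((hlim.eventually_lt_const hd).filter_mono nhdsWithin_le_nhds).and
    (self_mem_nhdsWithin (s := Set.Ioi 0))).exists
  exact ⟨δ, hδ, h⟩

/-- A set is totally bounded if, at every scale, its distance is controlled by the distance of the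
images under a map with totally bounded range. -/
theorem totallyBounded_of_forall_exists_map {α : Type*} [PseudoMetricSpace α] {s : Set α}
    (H : ∀ ε > 0, ∃ (X : Type) (_ : PseudoMetricSpace X) (Φ : s → X),
      TotallyBounded (Set.range Φ) ∧
        ∃ δ > 0, ∀ a b : s, dist (Φ a) (Φ b) < δ → dist (a : α) b < ε) :
    TotallyBounded s := by
  refine Metric.totallyBounded_iff.2 fun ε hε => ?_
  obtain ⟨X, _, Φ, hΦ, δ, hδ, h⟩ := H ε hε
  rw [← Set.image_univ] at hΦ
  obtain ⟨u, -, hu, hcov⟩ := Set.exists_subset_image_finite_and.1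
    (hΦ.exists_subset (Metric.dist_mem_uniformity hδ))
  refine ⟨(↑) '' u, hu.image _, fun a ha => ?_⟩
  have := hcov (Set.mem_image_of_mem Φ (Set.mem_univ ⟨a, ha⟩))
  simp only [Set.mem_iUnion, Set.mem_image, exists_prop] at this ⊢
  obtain ⟨_, ⟨b, hb, rfl⟩, hab⟩ := this
  exact ⟨b, ⟨b, hb, rfl⟩, h ⟨a, ha⟩ b hab⟩

theorem norm_sub_le_of_integral_sq_deriv_le {E : Type*} [NormedAddCommGroup E] [NormedSpace ℝ E]
    [CompleteSpace E] [SecondCountableTopology E] {g : ℝ → E} {A : ℝ} (hg : Differentiable ℝ g)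
    (hgi : Integrable (fun x => ‖deriv g x‖ ^ 2)) (hA : ∫ x, ‖deriv g x‖ ^ 2 ≤ A)
    {t : ℝ} (ht : 0 < t) (x y : ℝ) : ‖g y - g x‖ ≤ t * |y - x| + A / t := by
  wlog hxy : x ≤ y generalizing x y
  · rw [norm_sub_rev, abs_sub_comm]
    exact this y x (le_of_not_ge hxy)
  borelize E
  have hpt : ∀ z, ‖deriv g z‖ ≤ t + ‖deriv g z‖ ^ 2 / t := fun z => by
    rw [← sub_nonneg]
    have : t + ‖deriv g z‖ ^ 2 / t - ‖deriv g z‖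
        = ((t - ‖deriv g z‖ / 2) ^ 2 + 3 / 4 * ‖deriv g z‖ ^ 2) / t := by
      field_simp
      ring
    rw [this]
    positivity
  have hmaj : IntervalIntegrable (fun z => t + ‖deriv g z‖ ^ 2 / t) volume x y :=
    intervalIntegrable_const.add (hgi.div_const t).intervalIntegrable
  have hI : IntervalIntegrable (deriv g) volume x y :=
    hmaj.mono_fun (measurable_deriv g).aestronglyMeasurable
      (Eventually.of_forall fun z => (hpt z).trans (le_abs_self _))
  rw [← intervalIntegral.integral_deriv_eq_sub (fun z _ => hg z) hI,
    abs_of_nonneg (sub_nonneg.2 hxy)]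
  calc ‖∫ z in x..y, deriv g z‖ ≤ ∫ z in x..y, ‖deriv g z‖ :=
        intervalIntegral.norm_integral_le_integral_norm hxy
    _ ≤ ∫ z in x..y, (t + ‖deriv g z‖ ^ 2 / t) :=
        intervalIntegral.integral_mono_on hxy hI.norm hmaj fun z _ => hpt z
    _ = t * (y - x) + (∫ z in x..y, ‖deriv g z‖ ^ 2) / t := by
        rw [intervalIntegral.integral_add intervalIntegrable_const
          (hgi.div_const t).intervalIntegrable, intervalIntegral.integral_const,
          intervalIntegral.integral_div, smul_eq_mul, mul_comm]
    _ ≤ t * (y - x) + A / t := by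
        gcongr
        rw [intervalIntegral.integral_of_le hxy]
        exact (setIntegral_le_integral hgi (Eventually.of_forall fun z => by positivity)).trans hA

theorem norm_le_of_integral_sq_le_of_integral_sq_deriv_le {E : Type*} [NormedAddCommGroup E]
    [NormedSpace ℝ E] [CompleteSpace E] [SecondCountableTopology E] {g : ℝ → E} {A B : ℝ}
    (hg : Differentiable ℝ g)
    (hgi : Integrable (fun x => ‖g x‖ ^ 2)) (hA : ∫ x, ‖g x‖ ^ 2 ≤ A)
    (hgi' : Integrable (fun x => ‖deriv g x‖ ^ 2)) (hB : ∫ x, ‖deriv g x‖ ^ 2 ≤ B) (x : ℝ) :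
    ‖g x‖ ≤ A + B + 2 := by
  have hB0 : 0 ≤ B := (integral_nonneg fun z => by positivity).trans hB
  have hpt : ∀ y ∈ Set.Icc x (x + 1), ‖g x‖ ≤ ‖g y‖ ^ 2 + (B + 2) := fun y hy => by
    have h1 := norm_sub_le_of_integral_sq_deriv_le hg hgi' hB one_pos y x
    have h2 : |x - y| ≤ 1 := abs_le.2 ⟨by linarith [hy.2], by linarith [hy.1]⟩
    have h3 := norm_le_norm_add_norm_sub' (g x) (g y)
    nlinarith [sq_nonneg (‖g y‖ - 1 / 2)]
  have hI : IntervalIntegrable (fun y => ‖g y‖ ^ 2) volume x (x + 1) := hgi.intervalIntegrable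
  have hle : x ≤ x + 1 := by linarith
  have := intervalIntegral.integral_mono_on hle intervalIntegrable_const
    (hI.add intervalIntegrable_const) hpt
  rw [intervalIntegral.integral_add hI intervalIntegrable_const] at this
  simp only [intervalIntegral.integral_const, add_sub_cancel_left, one_smul] at this
  rw [intervalIntegral.integral_of_le hle] at this
  have h4 := (setIntegral_le_integral (s := Set.Ioc x (x + 1)) hgi
    (Eventually.of_forall fun z => by positivity)).trans hA
  linarith

/-- Over a compact set, the functions bounded in `H¹(ℝ)` form a totally bounded family for the
uniform distance. -/
theorem totallyBounded_range_restrict_of_integral_sq_le {E ι : Type*} [NormedAddCommGroup E]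
    [NormedSpace ℝ E] [FiniteDimensional ℝ E] {A B : ℝ} {g : ι → ℝ → E}
    (hg : ∀ i, Differentiable ℝ (g i))
    (hgi : ∀ i, Integrable (fun x => ‖g i x‖ ^ 2)) (hA : ∀ i, ∫ x, ‖g i x‖ ^ 2 ≤ A)
    (hgi' : ∀ i, Integrable (fun x => ‖deriv (g i) x‖ ^ 2))
    (hB : ∀ i, ∫ x, ‖deriv (g i) x‖ ^ 2 ≤ B) (s : Set ℝ) [CompactSpace s] :
    TotallyBounded (Set.range fun i => BoundedContinuousFunction.mkOfCompact
      (⟨s.domRestrict (g i), (hg i).continuous.continuousOn.domRestrict⟩ : C(s, E))) := by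
  have : ProperSpace E := FiniteDimensional.proper_real E
  have : CompleteSpace E := FiniteDimensional.complete ℝ E
  refine (BoundedContinuousFunction.arzela_ascoli (Metric.closedBall (0 : E) (A + B + 2))
    (isCompact_closedBall _ _) _ ?_ ?_).totallyBounded.subset subset_closure
  · rintro _ x ⟨i, rfl⟩
    exact mem_closedBall_zero_iff.2 (norm_le_of_integral_sq_le_of_integral_sq_deriv_le (hg i)
      (hgi i) (hA i) (hgi' i) (hB i) x)
  · refine UniformEquicontinuous.equicontinuous (Metric.uniformEquicontinuous_iff.2 fun ε hε => ?_)
    have hB' : 0 < |B| + 1 := by positivity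
    have ht : 0 < 2 * (|B| + 1) / ε := by positivity
    refine ⟨ε / 2 / (2 * (|B| + 1) / ε), by positivity, ?_⟩
    rintro x y hxy ⟨_, i, rfl⟩
    have h := norm_sub_le_of_integral_sq_deriv_le (hg i) (hgi' i)
      (((hB i).trans (le_abs_self B)).trans (lt_add_one _).le) ht y x
    rw [Subtype.dist_eq, Real.dist_eq, lt_div_iff₀ ht] at hxy
    have h2 : (|B| + 1) / (2 * (|B| + 1) / ε) = ε / 2 := by field_simp
    rw [dist_eq_norm]
    change ‖g i x - g i y‖ < ε
    linarith

theorem norm_sq_eq_integral_of_L2 {α E : Type*} [MeasurableSpace α] {μ : Measure α}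
    [NormedAddCommGroup E] [InnerProductSpace ℂ E] (f : Lp E 2 μ) :
    ‖f‖ ^ 2 = ∫ x, ‖f x‖ ^ 2 ∂μ := by
  have h : ((‖f‖ ^ 2 : ℝ) : ℂ) = ((∫ x, ‖f x‖ ^ 2 ∂μ : ℝ) : ℂ) := by
    rw [← integral_complex_ofReal]
    push_cast
    simpa [inner_self_eq_norm_sq_to_K] using L2.inner_def (𝕜 := ℂ) f f
  exact_mod_cast h

/-- The complexification of a real matrix satisfies the operator norm bound of the matrix. -/
theorem norm_ofReal_mulVec_le {n : Type*} [Fintype n] [DecidableEq n] (A : Matrix n n ℝ)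
    (v : EuclideanSpace ℂ n) :
    ‖(EuclideanSpace.equiv n ℂ).symm ((A.map (fun r : ℝ => (r : ℂ))).mulVec v)‖
      ≤ ‖Matrix.toEuclideanCLM (𝕜 := ℝ) A‖ * ‖v‖ := by
  have hsplit : ∀ w : EuclideanSpace ℂ n, ‖w‖ ^ 2
      = ‖WithLp.toLp 2 fun i => (w i).re‖ ^ 2 + ‖WithLp.toLp 2 fun i => (w i).im‖ ^ 2 := fun w => by
    simp only [EuclideanSpace.norm_sq_eq, ← Finset.sum_add_distrib]
    refine Finset.sum_congr rfl fun i _ => ?_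
    rw [← Complex.normSq_eq_norm_sq, Complex.normSq_apply]
    simp [sq]
  have hre := (Matrix.toEuclideanCLM (𝕜 := ℝ) A).le_opNorm (WithLp.toLp 2 fun i => (v i).re)
  have him := (Matrix.toEuclideanCLM (𝕜 := ℝ) A).le_opNorm (WithLp.toLp 2 fun i => (v i).im)
  refine le_of_sq_le_sq ?_ (by positivity)
  rw [mul_pow, hsplit v, hsplit, mul_add, ← mul_pow, ← mul_pow]
  refine add_le_add (le_trans (le_of_eq ?_) (pow_le_pow_left₀ (norm_nonneg _) hre 2))
    (le_trans (le_of_eq ?_) (pow_le_pow_left₀ (norm_nonneg _) him 2))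
  all_goals
    congr 2
    ext i
    simp [Matrix.mulVec, dotProduct]

/-- Kolmogorov–Riesz compactness mechanism: if `M : ℝ → ℝ^{2×2}` is differentiable
with `M` and `M′` bounded (in the operator norm induced by the Euclidean norm) and
`‖M(x)‖ → 0` as `|x| → ∞`, then for every `C > 0` the set of elements of
`L²(ℝ, ℂ²)` represented by `x ↦ M(x)g(x)`, where `g` ranges over differentiable
functions with `∫‖g‖² ≤ C²` and `∫‖g′‖² ≤ C²`, is totally bounded. -/
theorem vanishing_multiplication_operator_totally_bounded
    (M M' : ℝ → Matrix (Fin 2) (Fin 2) ℝ)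
    (hderiv : ∀ (i j : Fin 2) (x : ℝ), HasDerivAt (fun y : ℝ => M y i j) (M' x i j) x)
    (hMb : ∃ K : ℝ, ∀ x : ℝ, ‖Matrix.toEuclideanCLM (𝕜 := ℝ) (M x)‖ ≤ K)
    (hM'b : ∃ K : ℝ, ∀ x : ℝ, ‖Matrix.toEuclideanCLM (𝕜 := ℝ) (M' x)‖ ≤ K)
    (hM0 : Filter.Tendsto (fun x : ℝ => ‖Matrix.toEuclideanCLM (𝕜 := ℝ) (M x)‖)
      (Filter.cocompact ℝ) (nhds 0))
    (C : ℝ) (hC : 0 < C) :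
    TotallyBounded
      {F : Lp (E := EuclideanSpace ℂ (Fin 2)) 2 (volume : Measure ℝ) |
        ∃ g : ℝ → EuclideanSpace ℂ (Fin 2),
          Differentiable ℝ g ∧
          Integrable (fun x : ℝ => ‖g x‖ ^ 2) ∧ (∫ x : ℝ, ‖g x‖ ^ 2) ≤ C ^ 2 ∧
          Integrable (fun x : ℝ => ‖deriv g x‖ ^ 2) ∧ (∫ x : ℝ, ‖deriv g x‖ ^ 2) ≤ C ^ 2 ∧
          ∀ᵐ x : ℝ ∂volume,
            F x = (EuclideanSpace.equiv (Fin 2) ℂ).symm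
              (((M x).map (fun r : ℝ => (r : ℂ))).mulVec (g x))} := by
  obtain ⟨K, hK⟩ := hMb
  have hK0 : 0 ≤ K := (norm_nonneg _).trans (hK 0)
  set S : Set (Lp (EuclideanSpace ℂ (Fin 2)) 2 (volume : Measure ℝ)) := {F | _}
  choose g hg hgi hA hgi' hB hF using fun F : S => F.2
  refine totallyBounded_of_forall_exists_map fun ε hε => ?_
  obtain ⟨η, hη, hηε⟩ := exists_pos_mul_sq_lt (4 * C ^ 2) (show 0 < ε ^ 2 / 2 by positivity)
  obtain ⟨R, hR0, hR⟩ : ∃ R ≥ 0, ∀ x ∉ Set.Icc (-R) R,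
      ‖Matrix.toEuclideanCLM (𝕜 := ℝ) (M x)‖ ≤ η := by
    obtain ⟨r, hr⟩ := Metric.closedBall_compl_subset_of_mem_cocompact
      (hM0.eventually_le_const hη) 0
    refine ⟨max r 0, le_max_right _ _, fun x hx => hr fun hxr => hx ?_⟩
    rw [mem_closedBall_zero_iff, Real.norm_eq_abs] at hxr
    exact abs_le.1 (hxr.trans (le_max_left _ _))
  obtain ⟨δ, hδ, hδε⟩ := exists_pos_mul_sq_lt (2 * R * K ^ 2) (show 0 < ε ^ 2 / 2 by positivity)
  refine ⟨_, inferInstance, _, totallyBounded_range_restrict_of_integral_sq_le hg hgi hA hgi' hB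
    (Set.Icc (-R) R), δ, hδ, fun a b hab => ?_⟩
  have hclose : ∀ x ∈ Set.Icc (-R) R, ‖g a x - g b x‖ ≤ δ := fun x hx => by
    rw [← dist_eq_norm]
    exact (BoundedContinuousFunction.dist_coe_le_dist (⟨x, hx⟩ : Set.Icc (-R) R)).trans hab.le
  have hpt : ∀ᵐ x, ‖(a.1 - b.1) x‖ ^ 2
      ≤ (Set.Icc (-R) R).indicator (fun _ => (K * δ) ^ 2) x
        + η ^ 2 * (2 * ‖g a x‖ ^ 2 + 2 * ‖g b x‖ ^ 2) := by
    filter_upwards [Lp.coeFn_sub a.1 b.1, hF a, hF b] with x hx ha hb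
    rw [hx, Pi.sub_apply, ha, hb, ← map_sub, ← Matrix.mulVec_sub, ← WithLp.ofLp_sub]
    have hM := norm_ofReal_mulVec_le (M x) (g a x - g b x)
    by_cases hxR : x ∈ Set.Icc (-R) R
    · rw [Set.indicator_of_mem hxR]
      have : 0 ≤ η ^ 2 * (2 * ‖g a x‖ ^ 2 + 2 * ‖g b x‖ ^ 2) := by positivity
      refine le_add_of_le_of_nonneg (pow_le_pow_left₀ (norm_nonneg _) (hM.trans ?_) 2) this
      exact mul_le_mul (hK x) (hclose x hxR) (norm_nonneg _) hK0
    · rw [Set.indicator_of_notMem hxR, zero_add]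
      have hsub : ‖g a x - g b x‖ ^ 2 ≤ 2 * ‖g a x‖ ^ 2 + 2 * ‖g b x‖ ^ 2 := by
        have := pow_le_pow_left₀ (norm_nonneg _) (norm_sub_le (g a x) (g b x)) 2
        nlinarith [sq_nonneg (‖g a x‖ - ‖g b x‖)]
      refine (pow_le_pow_left₀ (norm_nonneg _)
        (hM.trans (mul_le_mul_of_nonneg_right (hR x hxR) (norm_nonneg _))) 2).trans ?_
      rw [mul_pow]
      gcongr
  have hi1 : Integrable ((Set.Icc (-R) R).indicator fun _ => (K * δ) ^ 2) :=
    (integrable_indicator_iff measurableSet_Icc).2 (integrableOn_const (by simp))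
  have hi2 : Integrable fun x => 2 * ‖g a x‖ ^ 2 + 2 * ‖g b x‖ ^ 2 :=
    ((hgi a).const_mul 2).add ((hgi b).const_mul 2)
  rw [dist_eq_norm]
  refine lt_of_pow_lt_pow_left₀ 2 hε.le ?_
  rw [norm_sq_eq_integral_of_L2]
  calc _ ≤ _ := integral_mono_of_nonneg (Eventually.of_forall fun x => by positivity)
          (hi1.add (hi2.const_mul (η ^ 2))) hpt
    _ = 2 * R * K ^ 2 * δ ^ 2
        + η ^ 2 * (2 * (∫ x, ‖g a x‖ ^ 2) + 2 * ∫ x, ‖g b x‖ ^ 2) := by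
      rw [integral_add' hi1 (hi2.const_mul (η ^ 2)), integral_indicator measurableSet_Icc,
        integral_const_mul, integral_add ((hgi a).const_mul 2) ((hgi b).const_mul 2),
        integral_const_mul, integral_const_mul, setIntegral_const, Measure.real, Real.volume_Icc,
        ENNReal.toReal_ofReal (by linarith), smul_eq_mul]
      ring
    _ ≤ 2 * R * K ^ 2 * δ ^ 2 + η ^ 2 * (2 * C ^ 2 + 2 * C ^ 2) := by
      gcongr
      exacts [hA a, hA b]
    _ < ε ^ 2 := by linarith
end
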